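/- Let B : U × U → V be a symmetric bilinear map with V finite-dimensional. If for every nonzero λ ∈ V* the index of the quadratic form λ ∘ Q_B is at least dim V, then Q_B is surjective. -/

import Mathlib

/-- The index of a real quadratic map: the supremum of dimensions of subspaces
on which it is negative-definite. -/
noncomputable def quadIndex {U : Type*} [AddCommGroup U] [Module ℝ U]
    (q : U → ℝ) : ℕ :=
  sSup {k | ∃ W : Submodule ℝ U, Module.finrank ℝ W = k ∧
    ∀ u ∈ W, u ≠ 0 → q u < 0}

open scoped InnerProductSpace

/-- The order-one and order-two necessary conditions for a quartic polynomial to have a minimum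
at the origin. -/
lemma eq_zero_and_nonneg_of_forall_quartic_nonneg {a b c d : ℝ}
    (h : ∀ t : ℝ, 0 ≤ a * t + b * t ^ 2 + c * t ^ 3 + d * t ^ 4) : a = 0 ∧ 0 ≤ b := by
  have ha : a = 0 := by
    have hmin : IsLocalMin (fun t : ℝ => a * t + b * t ^ 2 + c * t ^ 3 + d * t ^ 4) 0 :=
      Filter.Eventually.of_forall fun t => by simpa using h t
    have hder : HasDerivAt (fun t : ℝ => a * t + b * t ^ 2 + c * t ^ 3 + d * t ^ 4) a 0 := by
      have := ((((hasDerivAt_id (0 : ℝ)).const_mul a).add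
        ((hasDerivAt_pow 2 (0 : ℝ)).const_mul b)).add
        ((hasDerivAt_pow 3 (0 : ℝ)).const_mul c)).add
        ((hasDerivAt_pow 4 (0 : ℝ)).const_mul d)
      refine this.congr_deriv ?_
      norm_num
    exact hmin.hasDerivAt_eq_zero hder
  refine ⟨ha, ?_⟩
  subst ha
  have hlim : Filter.Tendsto (fun t : ℝ => b + c * t + d * t ^ 2) (nhdsWithin 0 {0}ᶜ)
      (nhds b) := by
    have hcont : Continuous fun t : ℝ => b + c * t + d * t ^ 2 := by fun_prop
    simpa using (hcont.tendsto 0).mono_left nhdsWithin_le_nhds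
  refine ge_of_tendsto hlim ?_
  filter_upwards [self_mem_nhdsWithin] with t ht
  have ht2 : 0 < t ^ 2 := by
    have : t ≠ 0 := ht
    positivity
  have := h t
  refine nonneg_of_mul_nonneg_right (a := t ^ 2) ?_ ht2
  linarith

section InnerProduct

variable {U V : Type*} [NormedAddCommGroup U] [InnerProductSpace ℝ U]
  [NormedAddCommGroup V] [InnerProductSpace ℝ V]

/-- A continuous quadratic form that is negative on `W \ {0}` is bounded away from zero
there. -/
lemma exists_forall_inner_le_neg_mul_norm_sq [FiniteDimensional ℝ U]
    (B : U →L[ℝ] U →L[ℝ] V) (l : V)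
    (W : Submodule ℝ U) (hW : ∀ u ∈ W, u ≠ 0 → ⟪l, B u u⟫_ℝ < 0) :
    ∃ c : ℝ, 0 < c ∧ ∀ u ∈ W, ⟪l, B u u⟫_ℝ ≤ -c * ‖u‖ ^ 2 := by
  have hcomp : IsCompact (Metric.sphere (0 : U) 1 ∩ W) :=
    (isCompact_sphere 0 1).inter_right W.closed_of_finiteDimensional
  have hcont : Continuous fun u : U => ⟪l, B u u⟫_ℝ := by fun_prop
  have key : ∃ c : ℝ, 0 < c ∧ ∀ u ∈ Metric.sphere (0 : U) 1 ∩ W, ⟪l, B u u⟫_ℝ ≤ -c := by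
    rcases (Metric.sphere (0 : U) 1 ∩ W).eq_empty_or_nonempty with hemp | hne
    · exact ⟨1, one_pos, by simp [hemp]⟩
    · obtain ⟨u, hu, hmax⟩ := hcomp.exists_isMaxOn hne hcont.continuousOn
      refine ⟨-⟪l, B u u⟫_ℝ, ?_, fun w hw => by simpa using hmax hw⟩
      have := hW u hu.2 (ne_zero_of_mem_unit_sphere (⟨u, hu.1⟩ : Metric.sphere (0 : U) 1))
      linarith
  obtain ⟨c, hc, hle⟩ := key
  refine ⟨c, hc, fun u hu => ?_⟩
  rcases eq_or_ne u 0 with rfl | hu0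
  · simp
  have hn : 0 < ‖u‖ := norm_pos_iff.mpr hu0
  have := hle (‖u‖⁻¹ • u) ⟨by simp [norm_smul, hn.ne'], W.smul_mem _ hu⟩
  simp only [map_smul, smul_apply, inner_smul_right] at this
  have h2 := mul_le_mul_of_nonneg_right this (sq_nonneg ‖u‖)
  field_simp at h2
  linarith

/-- If every `⟪l, B u u⟫` with `l ≠ 0` is negative-definite on a subspace of dimension at least
`d`, then it is so uniformly in `l`. -/
lemma exists_uniform_negative_bound [FiniteDimensional ℝ U] [FiniteDimensional ℝ V]
    (B : U →L[ℝ] U →L[ℝ] V) (d : ℕ)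
    (hind : ∀ l : V, l ≠ 0 → ∃ W : Submodule ℝ U, d ≤ Module.finrank ℝ W ∧
      ∀ u ∈ W, u ≠ 0 → ⟪l, B u u⟫_ℝ < 0) :
    ∃ c : ℝ, 0 < c ∧ ∀ l : V, l ≠ 0 → ∃ W : Submodule ℝ U, d ≤ Module.finrank ℝ W ∧
      ∀ u ∈ W, ⟪l, B u u⟫_ℝ ≤ -c * ‖l‖ * ‖u‖ ^ 2 := by
  have key : ∃ c : ℝ, 0 < c ∧ ∀ l ∈ Metric.sphere (0 : V) 1, ∃ W : Submodule ℝ U,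
      d ≤ Module.finrank ℝ W ∧ ∀ u ∈ W, ⟪l, B u u⟫_ℝ ≤ -c * ‖u‖ ^ 2 := by
    refine (isCompact_sphere (0 : V) 1).induction_on
      (p := fun S => ∃ c : ℝ, 0 < c ∧ ∀ l ∈ S, ∃ W : Submodule ℝ U,
        d ≤ Module.finrank ℝ W ∧ ∀ u ∈ W, ⟪l, B u u⟫_ℝ ≤ -c * ‖u‖ ^ 2)
      ⟨1, one_pos, by simp⟩ ?_ ?_ ?_
    · rintro S T hST ⟨c, hc, h⟩
      exact ⟨c, hc, fun l hl => h l (hST hl)⟩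
    · rintro S T ⟨c, hc, hS⟩ ⟨c', hc', hT⟩
      refine ⟨min c c', lt_min hc hc', ?_⟩
      rintro l (hl | hl)
      · obtain ⟨W, hW, hneg⟩ := hS l hl
        refine ⟨W, hW, fun u hu => (hneg u hu).trans ?_⟩
        gcongr
        exact min_le_left _ _
      · obtain ⟨W, hW, hneg⟩ := hT l hl
        refine ⟨W, hW, fun u hu => (hneg u hu).trans ?_⟩
        gcongr
        exact min_le_right _ _
    · intro l hl
      obtain ⟨W, hW, hneg⟩ :=
        hind l (ne_zero_of_mem_unit_sphere (⟨l, hl⟩ : Metric.sphere (0 : V) 1))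
      obtain ⟨c, hc, hle⟩ := exists_forall_inner_le_neg_mul_norm_sq B l W hneg
      have hr : 0 < c / 2 / (‖B‖ + 1) := by positivity
      refine ⟨Metric.ball l (c / 2 / (‖B‖ + 1)),
        mem_nhdsWithin_of_mem_nhds (Metric.ball_mem_nhds l hr), c / 2, by positivity, ?_⟩
      intro m hm
      refine ⟨W, hW, fun u hu => ?_⟩
      have hd : ‖m - l‖ * (‖B‖ + 1) ≤ c / 2 := by
        rw [mem_ball_iff_norm] at hm
        exact ((lt_div_iff₀ (by positivity)).mp hm).le
      have h1 : ⟪m - l, B u u⟫_ℝ ≤ c / 2 * ‖u‖ ^ 2 :=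
        calc ⟪m - l, B u u⟫_ℝ ≤ ‖m - l‖ * ‖B u u‖ := real_inner_le_norm _ _
          _ ≤ ‖m - l‖ * (‖B‖ * ‖u‖ * ‖u‖) := by gcongr; exact B.le_opNorm₂ u u
          _ ≤ ‖m - l‖ * ((‖B‖ + 1) * ‖u‖ * ‖u‖) := by gcongr; linarith
          _ = ‖m - l‖ * (‖B‖ + 1) * ‖u‖ ^ 2 := by ring
          _ ≤ c / 2 * ‖u‖ ^ 2 := by gcongr
      rw [inner_sub_left] at h1
      linarith [hle u hu]
  obtain ⟨c, hc, h⟩ := key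
  refine ⟨c, hc, fun l hl => ?_⟩
  have hn : 0 < ‖l‖ := norm_pos_iff.mpr hl
  obtain ⟨W, hW, hle⟩ := h (‖l‖⁻¹ • l) (by simp [norm_smul, hn.ne'])
  refine ⟨W, hW, fun u hu => ?_⟩
  have h2 := mul_le_mul_of_nonneg_left (hle u hu) hn.le
  rw [real_inner_smul_left, mul_inv_cancel_left₀ hn.ne'] at h2
  linarith

/-- The penalised distance `‖B v v - p‖² + ε ‖v‖²` has a minimiser. -/
lemma exists_penalised_minimiser [FiniteDimensional ℝ U]
    (B : U →L[ℝ] U →L[ℝ] V) (p : V) {ε : ℝ} (hε : 0 < ε) :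
    ∃ v : U, ∀ w : U, ‖B v v - p‖ ^ 2 + ε * ‖v‖ ^ 2 ≤ ‖B w w - p‖ ^ 2 + ε * ‖w‖ ^ 2 := by
  have hcont : Continuous fun v : U => ‖B v v - p‖ ^ 2 + ε * ‖v‖ ^ 2 := by fun_prop
  refine hcont.exists_forall_le ?_
  have hlim : Filter.Tendsto (fun v : U => ε * ‖v‖ ^ 2) (Filter.cocompact U) Filter.atTop :=
    ((Filter.tendsto_pow_atTop two_ne_zero).comp
      (tendsto_norm_cocompact_atTop (E := U))).const_mul_atTop hε
  exact Filter.tendsto_atTop_mono (fun v => by nlinarith [sq_nonneg ‖B v v - p‖]) hlim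

/-- Necessary conditions of orders one and two at a minimiser of the penalised distance. -/
lemma penalised_minimiser_conditions (B : U →L[ℝ] U →L[ℝ] V) (hB : ∀ u v, B u v = B v u)
    (p : V) (ε : ℝ) {v : U}
    (hv : ∀ w : U, ‖B v v - p‖ ^ 2 + ε * ‖v‖ ^ 2 ≤ ‖B w w - p‖ ^ 2 + ε * ‖w‖ ^ 2) (h : U) :
    ⟪B v v - p, B v h⟫_ℝ = -(ε / 2) * ⟪v, h⟫_ℝ ∧
      0 ≤ 4 * ‖B v h‖ ^ 2 + 2 * ⟪B v v - p, B h h⟫_ℝ + ε * ‖h‖ ^ 2 := by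
  have key : ∀ t : ℝ, 0 ≤ (4 * ⟪B v v - p, B v h⟫_ℝ + 2 * ε * ⟪v, h⟫_ℝ) * t
      + (4 * ‖B v h‖ ^ 2 + 2 * ⟪B v v - p, B h h⟫_ℝ + ε * ‖h‖ ^ 2) * t ^ 2
      + (4 * ⟪B v h, B h h⟫_ℝ) * t ^ 3 + ‖B h h‖ ^ 2 * t ^ 4 := by
    intro t
    have h1 := hv (v + t • h)
    have h2 : B (v + t • h) (v + t • h) - p
        = (B v v - p) + ((2 * t) • B v h + t ^ 2 • B h h) := by
      simp only [map_add, map_smul, add_apply, smul_apply, hB h v]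
      module
    rw [h2, norm_add_sq_real (B v v - p), norm_add_sq_real ((2 * t) • B v h),
      norm_add_sq_real v] at h1
    simp only [inner_add_right, real_inner_smul_left, real_inner_smul_right, norm_smul, mul_pow,
      Real.norm_eq_abs, sq_abs] at h1
    nlinarith [h1]
  obtain ⟨h1, h2⟩ := eq_zero_and_nonneg_of_forall_quartic_nonneg key
  exact ⟨by linarith, h2⟩

/-- At a minimiser of the penalised distance, the form `⟪B v v - p, B h h⟫` is almost
nonnegative somewhere on every subspace of dimension at least `dim V`. -/
lemma exists_mem_le_inner_of_penalised_minimiser [FiniteDimensional ℝ U] [FiniteDimensional ℝ V]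
    (B : U →L[ℝ] U →L[ℝ] V)
    (hB : ∀ u v, B u v = B v u) (p : V) {ε : ℝ} (hε : 0 < ε) {v : U}
    (hv : ∀ w : U, ‖B v v - p‖ ^ 2 + ε * ‖v‖ ^ 2 ≤ ‖B w w - p‖ ^ 2 + ε * ‖w‖ ^ 2)
    (hr : B v v - p ≠ 0) (W : Submodule ℝ U)
    (hW : Module.finrank ℝ V ≤ Module.finrank ℝ W) :
    ∃ h ∈ W, h ≠ 0 ∧ -(ε / 2) * ‖h‖ ^ 2 ≤ ⟪B v v - p, B h h⟫_ℝ := by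
  have hcond := penalised_minimiser_conditions B hB p ε hv
  have hker : ∀ h, B v h = 0 → -(ε / 2) * ‖h‖ ^ 2 ≤ ⟪B v v - p, B h h⟫_ℝ := by
    intro h hh
    have := (hcond h).2
    rw [hh, norm_zero] at this
    linarith
  let T : W →ₗ[ℝ] V := (B v : U →ₗ[ℝ] V).domRestrict W
  by_cases hinj : Function.Injective T
  · have hfin : Module.finrank ℝ W = Module.finrank ℝ V :=
      le_antisymm (LinearMap.finrank_le_finrank_of_injective hinj) hW
    have hsurj : Function.Surjective T :=
      (LinearMap.injective_iff_surjective_of_finrank_eq_finrank hfin).mp hinj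
    have hv0 : v ≠ 0 := by
      rintro rfl
      obtain ⟨w, hw⟩ := hsurj (B 0 0 - p)
      exact hr (by rw [← hw]; simp [T])
    have hvv := (hcond v).1
    rw [real_inner_self_eq_norm_sq] at hvv
    obtain ⟨⟨h, hhW⟩, hh⟩ := hsurj (B v v)
    have hh : B v h = B v v := hh
    refine ⟨h, hhW, ?_, ?_⟩
    · rintro rfl
      rw [← hh, map_zero, inner_zero_right] at hvv
      have : 0 < ‖v‖ := norm_pos_iff.mpr hv0
      have : 0 < ε / 2 * ‖v‖ ^ 2 := by positivity
      linarith
    · have hzero : B v (h - v) = 0 := by rw [map_sub, hh, sub_self]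
      have hort : ⟪v, h - v⟫_ℝ = 0 := by
        have := (hcond (h - v)).1
        rw [hzero, inner_zero_right] at this
        have hε' : -(ε / 2) ≠ 0 := by linarith
        exact (mul_eq_zero.mp this.symm).resolve_left hε'
      have hsum : B h h = B v v + B (h - v) (h - v) := by
        have : B (h - v) v = 0 := by rw [hB, hzero]
        calc B h h = B (v + (h - v)) (v + (h - v)) := by rw [add_sub_cancel]
          _ = B v v + B (h - v) (h - v) := by
            rw [map_add B, add_apply, map_add (B v), map_add (B (h - v)), hzero, this,
              add_zero, zero_add]
      have hnorm : ‖h‖ ^ 2 = ‖v‖ ^ 2 + ‖h - v‖ ^ 2 := by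
        have := norm_add_sq_real v (h - v)
        rw [add_sub_cancel, hort] at this
        linarith
      rw [hsum, hnorm, inner_add_right, hvv]
      linarith [hker _ hzero]
  · rw [← LinearMap.ker_eq_bot, Submodule.eq_bot_iff] at hinj
    push Not at hinj
    obtain ⟨⟨h, hhW⟩, hh, hne⟩ := hinj
    exact ⟨h, hhW, fun h0 => hne (by simpa using h0), hker h hh⟩

/-- The surjectivity criterion in Euclidean form. -/
lemma surjective_of_forall_exists_negative [FiniteDimensional ℝ U] [FiniteDimensional ℝ V]
    (B : U →L[ℝ] U →L[ℝ] V)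
    (hB : ∀ u v, B u v = B v u)
    (hind : ∀ l : V, l ≠ 0 → ∃ W : Submodule ℝ U, Module.finrank ℝ V ≤ Module.finrank ℝ W ∧
      ∀ u ∈ W, u ≠ 0 → ⟪l, B u u⟫_ℝ < 0) :
    Function.Surjective fun u => B u u := by
  obtain ⟨c, hc, hneg⟩ := exists_uniform_negative_bound B _ hind
  intro p
  have happrox : ∀ ε : ℝ, 0 < ε → ∃ v : U, ‖v‖ ^ 2 ≤ ‖p‖ / c ∧ c * ‖B v v - p‖ ≤ ε / 2 := by
    intro ε hε
    obtain ⟨v, hv⟩ := exists_penalised_minimiser B p hε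
    have hres : c * ‖B v v - p‖ ≤ ε / 2 := by
      rcases eq_or_ne (B v v - p) 0 with h0 | hr
      · rw [h0, norm_zero]
        linarith
      obtain ⟨W, hW, hle⟩ := hneg _ hr
      obtain ⟨h, hhW, hne, hge⟩ :=
        exists_mem_le_inner_of_penalised_minimiser B hB p hε hv hr W hW
      have hpos : 0 < ‖h‖ ^ 2 := by
        have := norm_pos_iff.mpr hne
        positivity
      refine le_of_mul_le_mul_right ?_ hpos
      linarith [hle h hhW]
    refine ⟨v, ?_, hres⟩
    have hvv := (penalised_minimiser_conditions B hB p ε hv v).1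
    rw [real_inner_self_eq_norm_sq] at hvv
    have hexp : ⟪B v v - p, B v v⟫_ℝ = ‖B v v - p‖ ^ 2 + ⟪B v v - p, p⟫_ℝ := by
      rw [← real_inner_self_eq_norm_sq, ← inner_add_right, sub_add_cancel]
    have hcs := neg_le_of_abs_le (abs_real_inner_le_norm (B v v - p) p)
    have hle : ε / 2 * ‖v‖ ^ 2 ≤ ‖B v v - p‖ * ‖p‖ := by
      linarith [sq_nonneg ‖B v v - p‖]
    rw [le_div_iff₀ hc]
    refine le_of_mul_le_mul_left ?_ (half_pos hε)
    calc ε / 2 * (‖v‖ ^ 2 * c) = c * (ε / 2 * ‖v‖ ^ 2) := by ring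
      _ ≤ c * (‖B v v - p‖ * ‖p‖) := by gcongr
      _ = c * ‖B v v - p‖ * ‖p‖ := by ring
      _ ≤ ε / 2 * ‖p‖ := by gcongr
  have hcont : Continuous fun u : U => B u u := by fun_prop
  have hclosed : IsClosed ((fun u : U => B u u) '' Metric.closedBall 0 √(‖p‖ / c)) :=
    ((isCompact_closedBall _ _).image hcont).isClosed
  have hmem : p ∈ (fun u : U => B u u) '' Metric.closedBall 0 √(‖p‖ / c) := by
    rw [← hclosed.closure_eq, Metric.mem_closure_iff]
    intro δ hδ
    obtain ⟨v, hv, hres⟩ := happrox (c * δ) (by positivity)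
    refine ⟨B v v, ⟨v, ?_, rfl⟩, ?_⟩
    · rw [mem_closedBall_zero_iff]
      exact Real.le_sqrt_of_sq_le hv
    · rw [dist_comm, dist_eq_norm]
      refine lt_of_mul_lt_mul_left (a := c) ?_ hc.le
      have : 0 < c * δ := by positivity
      linarith
  obtain ⟨u, -, hu⟩ := hmem
  exact ⟨u, hu⟩

end InnerProduct

/-- The supremum defining the index is attained. -/
lemma exists_finrank_eq_quadIndex {U : Type*} [AddCommGroup U] [Module ℝ U]
    [FiniteDimensional ℝ U] (q : U → ℝ) :
    ∃ W : Submodule ℝ U, Module.finrank ℝ W = quadIndex q ∧ ∀ u ∈ W, u ≠ 0 → q u < 0 := by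
  refine Nat.sSup_mem (s := {k | ∃ W : Submodule ℝ U, Module.finrank ℝ W = k ∧
    ∀ u ∈ W, u ≠ 0 → q u < 0}) ⟨0, ⊥, finrank_bot ℝ U, ?_⟩ ⟨Module.finrank ℝ U, ?_⟩
  · intro u hu hne
    exact absurd ((Submodule.mem_bot ℝ).mp hu) hne
  · rintro k ⟨W, rfl, -⟩
    exact W.finrank_le

theorem agrachev_sarychev_surjectivity
    {U V : Type*} [AddCommGroup U] [Module ℝ U] [FiniteDimensional ℝ U]
    [AddCommGroup V] [Module ℝ V] [FiniteDimensional ℝ V]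
    (B : U →ₗ[ℝ] U →ₗ[ℝ] V) (hB : ∀ u v, B u v = B v u)
    (hind : ∀ l : V →ₗ[ℝ] ℝ, l ≠ 0 →
      Module.finrank ℝ V ≤ quadIndex (fun u => l (B u u))) :
    Function.Surjective (fun u => B u u) := by
  let eU : U ≃ₗ[ℝ] EuclideanSpace ℝ (Fin (Module.finrank ℝ U)) :=
    LinearEquiv.ofFinrankEq _ _ (by simp)
  let eV : V ≃ₗ[ℝ] EuclideanSpace ℝ (Fin (Module.finrank ℝ V)) :=
    LinearEquiv.ofFinrankEq _ _ (by simp)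
  let C : EuclideanSpace ℝ (Fin (Module.finrank ℝ U)) →L[ℝ]
      EuclideanSpace ℝ (Fin (Module.finrank ℝ U)) →L[ℝ]
      EuclideanSpace ℝ (Fin (Module.finrank ℝ V)) :=
    LinearMap.toContinuousLinearMap (LinearMap.toContinuousLinearMap.toLinearMap ∘ₗ
      (B.compl₁₂ eU.symm.toLinearMap eU.symm.toLinearMap).compr₂ eV.toLinearMap)
  have hC : ∀ x y, C x y = eV (B (eU.symm x) (eU.symm y)) := fun x y => rfl
  have hsurj : Function.Surjective fun x => C x x := by
    refine surjective_of_forall_exists_negative C (fun x y => by rw [hC, hC, hB]) ?_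
    intro l hl
    let m : V →ₗ[ℝ] ℝ := (innerSL ℝ l).toLinearMap ∘ₗ eV.toLinearMap
    have hm : ∀ v, m v = ⟪l, eV v⟫_ℝ := fun v => rfl
    have hm0 : m ≠ 0 := by
      intro h0
      have := hm (eV.symm l)
      rw [h0, eV.apply_symm_apply, LinearMap.zero_apply] at this
      exact hl (inner_self_eq_zero.mp this.symm)
    obtain ⟨W, hW, hneg⟩ := exists_finrank_eq_quadIndex fun u => m (B u u)
    refine ⟨W.map eU.toLinearMap, ?_, ?_⟩
    · rw [LinearEquiv.finrank_map_eq, hW, finrank_euclideanSpace_fin]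
      exact hind m hm0
    · rintro _ ⟨u, hu, rfl⟩ hne
      have := hneg u hu (by rintro rfl; simp at hne)
      rw [hm] at this
      simpa [hC] using this
  intro p
  obtain ⟨x, hx⟩ := hsurj (eV p)
  exact ⟨eU.symm x, eV.injective hx⟩
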